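/- Let $S_1$ and $S_2$ be Puiseux monoids and $\phi \colon \mathcal P_{\mathrm{fin},0}(S_1) \to \mathcal P_{\mathrm{fin},0}(S_2)$ a monoid isomorphism. Then the map $\Phi \colon S_1 \to S_2$ defined by $\Phi(a) := \max \phi(\{0, a\})$ is a bijective monoid homomorphism (i.e., a monoid isomorphism) from $S_1$ to $S_2$. -/

import Mathlib

open scoped Pointwise NNRat

/-- The reduced finitary power monoid of an additive monoid `M`: the finite subsets of `M`
containing `0`, under setwise addition, viewed as an additive submonoid of `Finset M`. -/
def RFPM (M : Type*) [AddCommMonoid M] [DecidableEq M] : AddSubmonoid (Finset M) where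
  carrier := {X | (0 : M) ∈ X}
  zero_mem' := Finset.zero_mem_zero
  add_mem' := fun h1 h2 => by simpa using Finset.add_mem_add h1 h2

theorem mem_RFPM {M : Type*} [AddCommMonoid M] [DecidableEq M] {X : Finset M}
    (h : (0 : M) ∈ X) : X ∈ RFPM M := h

theorem zero_mem_of_mem_RFPM {M : Type*} [AddCommMonoid M] [DecidableEq M]
    (X : ↥(RFPM M)) : (0 : M) ∈ (X : Finset M) := X.2

namespace RFPM

open Finset

/-- For finitely many elements `x ≤ a` of a Puiseux monoid there is a single `N > 0` such that each
`N • x` is a sum of at most `N` copies of `a`. -/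
theorem exists_nsmul_eq_nsmul {S : AddSubmonoid ℚ≥0} (X : Finset S) (a : S)
    (ha : ∀ x ∈ X, x ≤ a) :
    ∃ N : ℕ, 0 < N ∧ ∀ x ∈ X, ∃ m ≤ N, N • x = m • a := by
  refine ⟨∏ x ∈ X, ((x : ℚ≥0) / a).den, prod_pos fun x _ => NNRat.den_pos _, fun x hx => ?_⟩
  set N := ∏ x ∈ X, ((x : ℚ≥0) / a).den
  have hxa : (x : ℚ≥0) ≤ a := ha x hx
  obtain ⟨c, hc⟩ : ((x : ℚ≥0) / a).den ∣ N := dvd_prod_of_mem _ hx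
  rcases eq_or_ne (a : ℚ≥0) 0 with h0 | h0
  · refine ⟨0, Nat.zero_le _, ?_⟩
    have hx0 : x = 0 := Subtype.ext (nonpos_iff_eq_zero.1 (h0 ▸ hxa))
    simp [hx0]
  · have key : (N : ℚ≥0) * x = (c * ((x : ℚ≥0) / a).num : ℕ) * a := by
      have hd := NNRat.mul_den_eq_num ((x : ℚ≥0) / a)
      rw [hc]
      push_cast
      rw [← hd]
      field_simp
    refine ⟨c * ((x : ℚ≥0) / a).num, ?_, Subtype.ext (by simpa [nsmul_eq_mul] using key)⟩
    have hle : ((c * ((x : ℚ≥0) / a).num : ℕ) : ℚ≥0) * a ≤ N * a := by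
      rw [← key]
      gcongr
    exact_mod_cast le_of_mul_le_mul_right hle (pos_iff_ne_zero.2 h0)

theorem sum_mem_card_nsmul {M ι : Type*} [AddCommMonoid M] [DecidableEq M] (X : Finset M)
    (s : Finset ι) (f : ι → M) (hf : ∀ i ∈ s, f i ∈ X) : ∑ i ∈ s, f i ∈ #s • X := by
  classical
  induction s using Finset.induction_on with
  | empty => simp
  | insert i s hi ih =>
    rw [sum_insert hi, card_insert_of_notMem hi, succ_nsmul']
    exact add_mem_add (hf i (mem_insert_self i s))
      (ih fun j hj => hf j (mem_insert_of_mem hj))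

/-- Adding `X` to a suitable multiple of `X` gives the same set as adding `{0, max X}`. -/
theorem exists_succ_nsmul_eq {S : AddSubmonoid ℚ≥0} (X : Finset S) (a : S)
    (h0 : 0 ∈ X) (haX : a ∈ X) (ha : ∀ x ∈ X, x ≤ a) :
    ∃ k : ℕ, (k + 1) • X = k • X + {0, a} := by
  obtain ⟨N, hN, hm⟩ := exists_nsmul_eq_nsmul X a ha
  refine ⟨#X * N, Subset.antisymm (fun y hy => ?_) ?_⟩
  · obtain ⟨f, rfl⟩ := Finset.mem_nsmul.1 hy
    rw [List.sum_ofFn]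
    obtain ⟨x, hx, hfib⟩ := exists_le_card_fiber_of_mul_le_card_of_maps_to
      (s := univ) (t := X) (f := fun i => (f i : S)) (n := N)
      (fun i _ => (f i).2) ⟨0, h0⟩ (by simp)
    obtain ⟨A, hAsub, hA⟩ := exists_subset_card_eq hfib
    have hAsum : ∑ i ∈ A, (f i : S) = N • x := by
      have h := sum_eq_card_nsmul fun i hi => (mem_filter.1 (hAsub hi)).2
      rwa [hA] at h
    have hAc : ∑ i ∈ Aᶜ, (f i : S) ∈ (#X * N + 1 - N) • X := by
      have h := sum_mem_card_nsmul X Aᶜ (fun i => (f i : S)) fun i _ => (f i).2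
      rwa [card_compl, Fintype.card_fin, hA] at h
    obtain ⟨z, hz, w, hw, hzw⟩ : ∃ z ∈ (N - 1) • X, ∃ w ∈ ({0, a} : Finset S), z + w = N • x := by
      obtain ⟨m, hmN, hmx⟩ := hm x hx
      rcases m with _ | m
      · exact ⟨0, zero_mem_nsmul h0, 0, by simp, by simp [hmx]⟩
      · exact ⟨m • a, nsmul_subset_nsmul_right h0 (Nat.le_sub_one_of_lt hmN) (nsmul_mem_nsmul haX),
          a, by simp, by rw [hmx, succ_nsmul]⟩
    have hk : #X * N = (N - 1) + (#X * N + 1 - N) := by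
      have : N ≤ #X * N := Nat.le_mul_of_pos_left N (card_pos.2 ⟨0, h0⟩)
      omega
    rw [← sum_add_sum_compl A, hAsum, ← hzw, add_right_comm]
    refine add_mem_add ?_ hw
    have h := add_mem_add hz hAc
    rwa [← add_nsmul, ← hk] at h
  · rw [succ_nsmul]
    exact add_subset_add_left (by simp [insert_subset_iff, h0, haX])

variable {S T : AddSubmonoid ℚ≥0}

/-- The largest element of a member of the reduced finitary power monoid. -/
def max (X : RFPM S) : S := (X : Finset S).max' ⟨0, X.2⟩

/-- The set `{0, a}` as a member of the reduced finitary power monoid. -/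
def pair (a : S) : RFPM S := ⟨{0, a}, mem_RFPM (mem_insert_self 0 {a})⟩

theorem le_max (X : RFPM S) {x : S} (hx : x ∈ (X : Finset S)) : x ≤ max X := le_max' _ _ hx

theorem max_mem (X : RFPM S) : max X ∈ (X : Finset S) := max'_mem _ _

theorem max_eq_of_mem_of_le (X : RFPM S) {a : S} (ha : a ∈ (X : Finset S))
    (h : ∀ x ∈ (X : Finset S), x ≤ a) : max X = a :=
  le_antisymm (h _ (max_mem X)) (le_max X ha)

theorem max_add (X Y : RFPM S) : max (X + Y) = max X + max Y := by
  refine max_eq_of_mem_of_le _ (add_mem_add (max_mem X) (max_mem Y)) fun z hz => ?_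
  obtain ⟨x, hx, y, hy, rfl⟩ := mem_add.1 hz
  exact add_le_add (le_max X hx) (le_max Y hy)

theorem max_pair (a : S) : max (pair a) = a :=
  max_eq_of_mem_of_le _ (by simp [pair]) (by simp [pair, ← Subtype.coe_le_coe])

theorem exists_succ_nsmul_eq_add_pair (X : RFPM S) :
    ∃ k : ℕ, (k + 1) • X = k • X + pair (max X) := by
  obtain ⟨k, hk⟩ := exists_succ_nsmul_eq (X : Finset S) (max X) X.2 (max_mem X)
    fun x hx => le_max X hx
  exact ⟨k, Subtype.ext (by simpa [pair] using hk)⟩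

theorem max_map_pair_max (φ : RFPM S ≃+ RFPM T) (X : RFPM S) :
    max (φ (pair (max X))) = max (φ X) := by
  obtain ⟨k, hk⟩ := exists_succ_nsmul_eq_add_pair X
  have h := congrArg (fun Y => max (φ Y)) hk
  simp only [succ_nsmul, map_add, max_add] at h
  exact (add_left_cancel h).symm

/-- The isomorphism of Puiseux monoids `a ↦ max φ({0, a})`. -/
def maxEquiv (φ : RFPM S ≃+ RFPM T) : S ≃+ T where
  toFun a := max (φ (pair a))
  invFun b := max (φ.symm (pair b))
  left_inv a := by simp [max_map_pair_max, max_pair]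
  right_inv b := by simp [max_map_pair_max, max_pair]
  map_add' a b := by
    have h := max_map_pair_max φ (pair a + pair b)
    rwa [max_add, max_pair, max_pair, map_add, max_add] at h

end RFPM

/-- Given an isomorphism `φ` between the reduced finitary power monoids of two Puiseux
monoids `S₁` and `S₂`, the map `a ↦ max φ({0, a})` is a monoid isomorphism `S₁ → S₂`. -/
theorem max_of_iso_is_iso (S₁ S₂ : AddSubmonoid ℚ≥0)
    (φ : ↥(RFPM ↥S₁) ≃+ ↥(RFPM ↥S₂)) :
    ∃ Φ : ↥S₁ ≃+ ↥S₂, ∀ a : ↥S₁,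
      Φ a =
        ((φ ⟨({0, a} : Finset ↥S₁), mem_RFPM (Finset.mem_insert_self 0 {a})⟩ :
            ↥(RFPM ↥S₂)) : Finset ↥S₂).max'
          ⟨0, zero_mem_of_mem_RFPM _⟩ :=
  ⟨RFPM.maxEquiv φ, fun _ => rfl⟩
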